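/- arXiv:1606.05115 — 2 statements merged into one kernel-verified Lean document; each statement's English description precedes it below -/
import Mathlib

section
/- Let p be a real number with p < 0 or p > 1 and q, r ∈ (1,∞). Set a = 1 + q/r* − q/p, where 1/r + 1/r* = 1. Then for every k ∈ (0,1), the function K_{p,q,r} is differentiable at k with dK_{p,q,r}/dk = (a·E_{p,q,r}(k) − (a − k^q)·K_{p,q,r}(k))/(k·(1−k^q)). -/
open Real MeasureTheory Set Filter

/-- The Euler Beta function. -/
noncomputable def Beta (x y : ℝ) : ℝ := Real.Gamma x * Real.Gamma y / Real.Gamma (x + y)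

/-- The generalized complete elliptic integral of the first kind. -/
noncomputable def genK (p q r k : ℝ) : ℝ :=
  ∫ t in (0:ℝ)..1, (1 - t ^ q) ^ (-(1 / p)) * (1 - k ^ q * t ^ q) ^ (-(1 / r))

/-- The generalized complete elliptic integral of the second kind.
Here `1 - 1/r` is `1/r*` for the Hölder conjugate `r*` of `r`. -/
noncomputable def genE (p q r k : ℝ) : ℝ :=
  ∫ t in (0:ℝ)..1, (1 - k ^ q * t ^ q) ^ (1 - 1 / r) * (1 - t ^ q) ^ (-(1 / p))

theorem aux_w_int (p q : ℝ) (hp : p < 0 ∨ 1 < p) (hq : 1 < q) :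
    IntervalIntegrable (fun t : ℝ => (1 - t ^ q) ^ (-(1 / p))) volume 0 1 := by
  have hc : Continuous (fun t : ℝ => 1 - t ^ q) :=
    continuous_const.sub (Real.continuous_rpow_const (by linarith))
  rcases hp with hp | hp
  · apply Continuous.intervalIntegrable
    have : 0 ≤ -(1 / p) := by
      have := one_div_neg.mpr hp
      linarith
    exact (Real.continuous_rpow_const this).comp hc
  · have h1 : 1 / p < 1 := by
      rw [div_lt_one (by linarith)]; exact hp
    have h0 : 0 < 1 / p := by positivity
    have hb : IntervalIntegrable (fun t : ℝ => (1 - t) ^ (-(1 / p))) volume 0 1 := by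
      have := (intervalIntegral.intervalIntegrable_rpow' (a := 0) (b := 1)
        (r := -(1 / p)) (by linarith)).comp_sub_left 1
      simpa using this.symm
    refine hb.mono_fun' ?_ ?_
    · exact (hc.measurable.pow_const _).aestronglyMeasurable
    · rw [uIoc_of_le zero_le_one, Filter.EventuallyLE, ae_restrict_iff' measurableSet_Ioc]
      have : ∀ᵐ t : ℝ ∂volume, t ≠ 1 := by
        simp [ae_iff]
      filter_upwards [this] with t ht1 ht
      have hlt : t < 1 := lt_of_le_of_ne ht.2 ht1
      have h2 : t ^ q ≤ t := by
        have := Real.rpow_le_rpow_of_exponent_ge ht.1 ht.2 hq.le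
        simpa using this
      rw [Real.norm_of_nonneg (Real.rpow_nonneg (by linarith) _)]
      exact Real.rpow_le_rpow_of_nonpos (by linarith) (by linarith) (by linarith)

theorem aux_D_pos (q k t : ℝ) (hq : 1 < q) (hk : k ∈ Ioo (0:ℝ) 1) (ht : t ∈ Icc (0:ℝ) 1) :
    0 < 1 - k ^ q * t ^ q := by
  have h1 : k ^ q < 1 := Real.rpow_lt_one hk.1.le hk.2 (by linarith)
  have h2 : t ^ q ≤ 1 := Real.rpow_le_one ht.1 ht.2 (by linarith)
  have h3 : 0 ≤ t ^ q := Real.rpow_nonneg ht.1 _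
  have h4 : 0 < k ^ q := Real.rpow_pos_of_pos hk.1 _
  nlinarith

theorem aux_D_cont (q k e : ℝ) (hq : 1 < q) (hk : k ∈ Ioo (0:ℝ) 1) :
    ContinuousOn (fun t : ℝ => (1 - k ^ q * t ^ q) ^ e) (Icc 0 1) := by
  have hc : Continuous (fun t : ℝ => 1 - k ^ q * t ^ q) :=
    continuous_const.sub (continuous_const.mul (Real.continuous_rpow_const (by linarith)))
  exact hc.continuousOn.rpow_const fun t ht => Or.inl (aux_D_pos q k t hq hk ht).ne'

theorem aux_deriv (p q r : ℝ) (hp : p < 0 ∨ 1 < p) (hq : 1 < q) (hr : 1 < r)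
    (k : ℝ) (hk : k ∈ Ioo (0:ℝ) 1) :
    HasDerivAt (genK p q r)
      (∫ t in (0:ℝ)..1, (1 - t ^ q) ^ (-(1 / p)) *
        ((1 / r) * (q * k ^ (q - 1) * t ^ q) * (1 - k ^ q * t ^ q) ^ (-(1 / r) - 1))) k := by
  have hw := aux_w_int p q hp hq
  have hr0 : 0 < 1 / r := by positivity
  set b := (1 + k) / 2 with hb
  have hb' : b ∈ Ioo (0:ℝ) 1 := ⟨by linarith [hk.1], by linarith [hk.2]⟩
  have hs : Ioo 0 b ∈ nhds k := Ioo_mem_nhds hk.1 (by linarith [hk.2])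
  have hIcc : uIcc (0:ℝ) 1 = Icc 0 1 := uIcc_of_le zero_le_one
  have hInt : ∀ x ∈ Ioo (0:ℝ) 1, IntervalIntegrable (fun t : ℝ =>
      (1 - t ^ q) ^ (-(1 / p)) * (1 - x ^ q * t ^ q) ^ (-(1 / r))) volume 0 1 := by
    intro x hx
    exact hw.mul_continuousOn (by rw [hIcc]; exact aux_D_cont q x _ hq hx)
  have hInt' : IntervalIntegrable (fun t : ℝ => (1 - t ^ q) ^ (-(1 / p)) *
        ((1 / r) * (q * k ^ (q - 1) * t ^ q) * (1 - k ^ q * t ^ q) ^ (-(1 / r) - 1)))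
        volume 0 1 := by
    apply hw.mul_continuousOn
    rw [hIcc]
    refine ContinuousOn.mul ?_ (aux_D_cont q k _ hq hk)
    exact (continuous_const.mul (continuous_const.mul
      (Real.continuous_rpow_const (by linarith)))).continuousOn
  have hsub : ∀ x ∈ Ioo 0 b, x ∈ Ioo (0:ℝ) 1 := fun x hx => ⟨hx.1, hx.2.trans hb'.2⟩
  refine (intervalIntegral.hasDerivAt_integral_of_dominated_loc_of_deriv_le (𝕜 := ℝ)
    (F := fun x t : ℝ => (1 - t ^ q) ^ (-(1 / p)) * (1 - x ^ q * t ^ q) ^ (-(1 / r)))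
    (F' := fun x t : ℝ => (1 - t ^ q) ^ (-(1 / p)) *
        ((1 / r) * (q * x ^ (q - 1) * t ^ q) * (1 - x ^ q * t ^ q) ^ (-(1 / r) - 1)))
    (bound := fun t : ℝ => (1 - t ^ q) ^ (-(1 / p)) *
        ((1 / r) * q * (1 - b ^ q) ^ (-(1 / r) - 1)))
    hs ?_ (hInt k hk) ?_ ?_ ?_ ?_).2
  · filter_upwards [hs] with x hx
    have := (hInt x (hsub x hx)).aestronglyMeasurable
    rwa [uIoc_of_le zero_le_one]
  · have := hInt'.aestronglyMeasurable
    rwa [uIoc_of_le zero_le_one]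
  · refine Eventually.of_forall fun t ht x hx => ?_
    rw [uIoc_of_le zero_le_one] at ht
    have ht' : t ∈ Icc (0:ℝ) 1 := ⟨ht.1.le, ht.2⟩
    have hD := aux_D_pos q x t hq (hsub x hx) ht'
    have hbq : b ^ q < 1 := Real.rpow_lt_one hb'.1.le hb'.2 (by linarith)
    have h2 : t ^ q ≤ 1 := Real.rpow_le_one ht.1.le ht.2 (by linarith)
    have h3 : 0 ≤ t ^ q := Real.rpow_nonneg ht.1.le _
    have hxb : x ^ q ≤ b ^ q := Real.rpow_le_rpow hx.1.le hx.2.le (by linarith)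
    have hx0 : 0 ≤ x ^ q := Real.rpow_nonneg hx.1.le _
    have hx1 : 0 ≤ x ^ (q - 1) := Real.rpow_nonneg hx.1.le _
    have hx2 : x ^ (q - 1) ≤ 1 :=
      Real.rpow_le_one hx.1.le (hsub x hx).2.le (by linarith)
    have hD1 : 1 - b ^ q ≤ 1 - x ^ q * t ^ q := by nlinarith
    have hD2 : (1 - x ^ q * t ^ q) ^ (-(1 / r) - 1) ≤ (1 - b ^ q) ^ (-(1 / r) - 1) :=
      Real.rpow_le_rpow_of_nonpos (by linarith) hD1 (by linarith)
    have hD3 : 0 ≤ (1 - x ^ q * t ^ q) ^ (-(1 / r) - 1) := Real.rpow_nonneg hD.le _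
    have hw0 : 0 ≤ (1 - t ^ q) ^ (-(1 / p)) := Real.rpow_nonneg (by linarith) _
    have hq0 : 0 < q := by linarith
    rw [Real.norm_of_nonneg (by positivity)]
    have hm : q * x ^ (q - 1) * t ^ q ≤ q := by
      have : x ^ (q - 1) * t ^ q ≤ 1 := mul_le_one₀ hx2 h3 h2
      nlinarith
    gcongr
  · exact hw.mul_const _
  · refine Eventually.of_forall fun t ht x hx => ?_
    rw [uIoc_of_le zero_le_one] at ht
    have hD := aux_D_pos q x t hq (hsub x hx) ⟨ht.1.le, ht.2⟩
    have h1 : HasDerivAt (fun x : ℝ => 1 - x ^ q * t ^ q) (-(q * x ^ (q - 1) * t ^ q)) x :=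
      ((Real.hasDerivAt_rpow_const (Or.inl hx.1.ne')).mul_const _).const_sub 1
    have h2 := (h1.rpow_const (p := -(1 / r)) (Or.inl hD.ne')).const_mul
      ((1 - t ^ q) ^ (-(1 / p)))
    exact h2.congr_deriv (by ring)

theorem aux_F (p q r : ℝ) (hp : p < 0 ∨ 1 < p) (hq : 1 < q)
    (k : ℝ) (hk : k ∈ Ioo (0:ℝ) 1) :
    ∫ t in (0:ℝ)..1, (1 - t ^ q) ^ (-(1 / p)) * (((1 - t ^ q) * (1 - k ^ q * t ^ q)
        - q * (1 - 1 / p) * t ^ q * (1 - k ^ q * t ^ q)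
        + (q * (1 / r)) * k ^ q * t ^ q * (1 - t ^ q)) *
        (1 - k ^ q * t ^ q) ^ (-(1 / r) - 1)) = 0 := by
  have hIcc : uIcc (0:ℝ) 1 = Icc 0 1 := uIcc_of_le zero_le_one
  have hq0 : 0 < q := by linarith
  have hp1 : 0 < 1 - 1 / p := by
    rcases hp with h | h
    · have := one_div_neg.mpr h
      linarith
    · have : 1 / p < 1 := by rw [div_lt_one (by linarith)]; exact h
      linarith
  have hct : Continuous (fun t : ℝ => t ^ q) := Real.continuous_rpow_const hq0.le
  have key := intervalIntegral.integral_eq_sub_of_hasDerivAt_of_le (a := (0:ℝ)) (b := 1)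
    (f := fun t : ℝ => t * (1 - t ^ q) ^ (1 - 1 / p) * (1 - k ^ q * t ^ q) ^ (-(1 / r)))
    (f' := fun t : ℝ => (1 - t ^ q) ^ (-(1 / p)) * (((1 - t ^ q) * (1 - k ^ q * t ^ q)
        - q * (1 - 1 / p) * t ^ q * (1 - k ^ q * t ^ q)
        + (q * (1 / r)) * k ^ q * t ^ q * (1 - t ^ q)) *
        (1 - k ^ q * t ^ q) ^ (-(1 / r) - 1))) zero_le_one ?_ ?_ ?_
  · rw [key]
    simp
    left
    rw [Real.zero_rpow]
    simpa using hp1.ne'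
  · refine ContinuousOn.mul ?_ (aux_D_cont q k _ hq hk)
    exact (continuous_id.mul ((Real.continuous_rpow_const hp1.le).comp
      (continuous_const.sub hct))).continuousOn
  · intro t ht
    have hD := aux_D_pos q k t hq hk ⟨ht.1.le, ht.2.le⟩
    have hT : 0 < 1 - t ^ q := by
      have := Real.rpow_lt_one ht.1.le ht.2 hq0
      linarith
    have h0 : HasDerivAt (fun t : ℝ => t ^ q) (q * t ^ (q - 1)) t :=
      Real.hasDerivAt_rpow_const (Or.inl ht.1.ne')
    have h1 := (h0.const_sub 1).rpow_const (p := 1 - 1 / p) (Or.inl hT.ne')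
    have h2 := ((h0.const_mul (k ^ q)).const_sub 1).rpow_const (p := -(1 / r)) (Or.inl hD.ne')
    have h3 := ((hasDerivAt_id t).mul h1).mul h2
    refine h3.congr_deriv ?_
    simp only [id, Pi.mul_apply]
    have e1 : (1 - t ^ q) ^ (1 - 1 / p) = (1 - t ^ q) ^ (-(1 / p)) * (1 - t ^ q) := by
      rw [← Real.rpow_add_one hT.ne']; congr 1; ring
    have e2 : (1 - t ^ q) ^ (1 - 1 / p - 1) = (1 - t ^ q) ^ (-(1 / p)) := by
      congr 1; ring
    have e3 : (1 - k ^ q * t ^ q) ^ (-(1 / r)) =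
        (1 - k ^ q * t ^ q) ^ (-(1 / r) - 1) * (1 - k ^ q * t ^ q) := by
      rw [← Real.rpow_add_one hD.ne']; congr 1; ring
    have e4 : t ^ q = t ^ (q - 1) * t := by
      rw [← Real.rpow_add_one ht.1.ne']; congr 1; ring
    rw [e1, e2, e3]
    generalize (1 - t ^ q) ^ (-(1 / p)) = W
    generalize (1 - k ^ q * t ^ q) ^ (-(1 / r) - 1) = V
    rw [e4]
    ring
  · apply (aux_w_int p q hp hq).mul_continuousOn
    rw [hIcc]
    refine ContinuousOn.mul ?_ (aux_D_cont q k _ hq hk)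
    fun_prop

theorem genK_hasDerivAt (p q r : ℝ) (hp : p < 0 ∨ 1 < p) (hq : 1 < q) (hr : 1 < r)
    (rs : ℝ) (hrs : 1 / r + 1 / rs = 1) (a : ℝ) (ha : a = 1 + q / rs - q / p)
    (k : ℝ) (hk : k ∈ Ioo (0:ℝ) 1) :
    HasDerivAt (genK p q r)
      ((a * genE p q r k - (a - k ^ q) * genK p q r k) / (k * (1 - k ^ q))) k := by
  refine (aux_deriv p q r hp hq hr k hk).congr_deriv ?_
  have hF := aux_F p q r hp hq k hk
  have hw := aux_w_int p q hp hq
  have hIcc : uIcc (0:ℝ) 1 = Icc 0 1 := uIcc_of_le zero_le_one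
  have hq0 : 0 < q := by linarith
  have hct : Continuous (fun t : ℝ => t ^ q) := Real.continuous_rpow_const hq0.le
  have hk0 : 0 < k := hk.1
  have hkq : k ^ q < 1 := Real.rpow_lt_one hk.1.le hk.2 hq0
  have hkk : k ^ q = k ^ (q - 1) * k := by
    rw [← Real.rpow_add_one hk0.ne']; congr 1; ring
  have ha' : a = 1 + q * (1 - 1 / r) - q * (1 / p) := by
    have : 1 / rs = 1 - 1 / r := by linarith
    rw [ha, div_eq_mul_one_div q rs, div_eq_mul_one_div q p, this]
  rw [eq_div_iff (by have : 0 < 1 - k ^ q := by linarith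
                     positivity)]
  have iK : IntervalIntegrable (fun t : ℝ =>
      (1 - t ^ q) ^ (-(1 / p)) * (1 - k ^ q * t ^ q) ^ (-(1 / r))) volume 0 1 :=
    hw.mul_continuousOn (by rw [hIcc]; exact aux_D_cont q k _ hq hk)
  have iE : IntervalIntegrable (fun t : ℝ =>
      (1 - k ^ q * t ^ q) ^ (1 - 1 / r) * (1 - t ^ q) ^ (-(1 / p))) volume 0 1 :=
    hw.continuousOn_mul (by rw [hIcc]; exact aux_D_cont q k _ hq hk)
  have iF : IntervalIntegrable (fun t : ℝ =>
      (1 - t ^ q) ^ (-(1 / p)) * (((1 - t ^ q) * (1 - k ^ q * t ^ q)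
        - q * (1 - 1 / p) * t ^ q * (1 - k ^ q * t ^ q)
        + (q * (1 / r)) * k ^ q * t ^ q * (1 - t ^ q)) *
        (1 - k ^ q * t ^ q) ^ (-(1 / r) - 1))) volume 0 1 := by
    apply hw.mul_continuousOn
    rw [hIcc]
    refine ContinuousOn.mul ?_ (aux_D_cont q k _ hq hk)
    fun_prop
  have h0 : ∀ z : ℝ, z = 0 → a * genE p q r k - (a - k ^ q) * genK p q r k =
      a * genE p q r k - (a - k ^ q) * genK p q r k - k ^ q * z := by
    intro z hz
    rw [hz]; ring
  rw [h0 _ hF]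
  unfold genE genK
  rw [← intervalIntegral.integral_const_mul, ← intervalIntegral.integral_const_mul,
    ← intervalIntegral.integral_const_mul, ← intervalIntegral.integral_mul_const,
    ← intervalIntegral.integral_sub (iE.const_mul _) (iK.const_mul _),
    ← intervalIntegral.integral_sub ((iE.const_mul _).sub (iK.const_mul _)) (iF.const_mul _)]
  apply intervalIntegral.integral_congr
  intro t ht
  rw [hIcc] at ht
  have hD := aux_D_pos q k t hq hk ht
  have e3 : (1 - k ^ q * t ^ q) ^ (-(1 / r)) =
      (1 - k ^ q * t ^ q) ^ (-(1 / r) - 1) * (1 - k ^ q * t ^ q) := by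
    rw [← Real.rpow_add_one hD.ne']; congr 1; ring
  have e5 : (1 - k ^ q * t ^ q) ^ (1 - 1 / r) =
      (1 - k ^ q * t ^ q) ^ (-(1 / r) - 1) * (1 - k ^ q * t ^ q) * (1 - k ^ q * t ^ q) := by
    rw [← Real.rpow_add_one hD.ne', ← Real.rpow_add_one hD.ne']; congr 1; ring
  simp only []
  rw [e5, e3, ha']
  generalize (1 - t ^ q) ^ (-(1 / p)) = W
  generalize (1 - k ^ q * t ^ q) ^ (-(1 / r) - 1) = V
  rw [hkk]
  ring
end

section
/- Let p be a real number with p < 0 or p > 1 and q, r ∈ (1,∞). Then for every k ∈ [0,1), K_{p,q,r}(k) = (π_{p,q}/2) · Σ_{n=0}^{∞} [(1/q)_n (1/r)_n / ((1 − 1/p + 1/q)_n · n!)] · k^{q n}, where (x)_n = x(x+1)⋯(x+n−1) denotes the ascending Pochhammer symbol; in particular the series converges. -/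
open Real MeasureTheory Set Filter Polynomial

lemma aux_binom (s x : ℝ) (hx : |x| < 1) :
    HasSum (fun n : ℕ => (ascPochhammer ℝ n).eval s / (n.factorial : ℝ) * x ^ n)
      ((1 - x) ^ (-s)) := by
  have h := (Real.one_div_one_sub_rpow_hasFPowerSeriesOnBall_zero s).hasSum (y := x)
    (by simpa [enorm_eq_nnnorm] using! hx)
  have h1 : (1 - (0 + x)) = 1 - x := by ring
  have hx1 : 0 ≤ 1 - x := by have := (abs_lt.mp hx).2; linarith
  rw [h1, one_div, ← Real.rpow_neg hx1] at h
  refine Eq.mp (congrArg (fun F : ℕ → ℝ => HasSum F _) (funext fun n => Eq.symm ?_)) h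
  have h2 := Ring.factorial_nsmul_multichoose_eq_ascPochhammer s n
  rw [Polynomial.ascPochhammer_smeval_eq_eval, Ring.multichoose_eq, nsmul_eq_mul] at h2
  have h3 : (n.factorial : ℝ) ≠ 0 := by positivity
  rw [← h2, mul_div_cancel_left₀ _ h3]
  simp [mul_comm]

lemma aux_mem {q t : ℝ} (hq : 1 < q) (h0 : 0 ≤ t) (h1 : t ≤ 1) :
    0 ≤ t ^ q ∧ t ^ q ≤ t := by
  refine ⟨by positivity, ?_⟩
  rcases h0.eq_or_lt with h | h
  · rw [← h, Real.zero_rpow (by linarith)]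
  · simpa using Real.rpow_le_rpow_of_exponent_ge h h1 hq.le

lemma aux_meas (a q : ℝ) : Measurable (fun t : ℝ => (1 - t ^ q) ^ a) := by fun_prop

lemma aux_int {a q : ℝ} (ha : -1 < a) (hq : 1 < q) :
    IntervalIntegrable (fun t : ℝ => (1 - t ^ q) ^ a) volume 0 1 := by
  have hb : IntervalIntegrable (fun t : ℝ => (1 - t) ^ a + 1) volume 0 1 := by
    have h := (intervalIntegral.intervalIntegrable_rpow' (a := 0) (b := 1) ha).comp_sub_left 1
    simp only [sub_zero, sub_self] at h
    exact h.symm.add intervalIntegrable_const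
  refine hb.mono_fun (aux_meas a q).aestronglyMeasurable ?_
  have hne : ∀ᵐ t : ℝ ∂(volume.restrict (uIoc 0 1)), t ≠ 1 :=
    ae_restrict_of_ae (by simp [ae_iff, measure_singleton])
  filter_upwards [ae_restrict_mem measurableSet_uIoc, hne] with t ht ht1
  rw [uIoc_of_le zero_le_one] at ht
  have htlt : t < 1 := lt_of_le_of_ne ht.2 ht1
  obtain ⟨hu0, hu1⟩ := aux_mem hq ht.1.le ht.2
  have hA : 0 ≤ (1 - t ^ q) ^ a := Real.rpow_nonneg (by linarith) _
  have hB : 0 ≤ (1 - t) ^ a := Real.rpow_nonneg (by linarith) _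
  rw [Real.norm_of_nonneg hA, Real.norm_of_nonneg (by linarith)]
  rcases le_or_gt 0 a with h | h
  · have := Real.rpow_le_one (x := 1 - t ^ q) (by linarith) (by linarith) h
    linarith
  · have := Real.rpow_le_rpow_of_nonpos (x := 1 - t) (y := 1 - t ^ q) (by linarith) (by linarith) h.le
    linarith

lemma aux_intn {a q : ℝ} (ha : -1 < a) (hq : 1 < q) (n : ℕ) :
    IntervalIntegrable (fun t : ℝ => (t ^ q) ^ n * (1 - t ^ q) ^ a) volume 0 1 := by
  refine (aux_int ha hq).continuousOn_mul ?_
  exact ((Real.continuous_rpow_const (by linarith)).pow n).continuousOn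

lemma aux_rec {a q : ℝ} (ha : -1 < a) (hq : 1 < q) (n : ℕ) :
    (a + 1 + 1 / q + n) * (∫ t in (0:ℝ)..1, (t ^ q) ^ (n + 1) * (1 - t ^ q) ^ a)
      = (1 / q + n) * ∫ t in (0:ℝ)..1, (t ^ q) ^ n * (1 - t ^ q) ^ a := by
  have hc : Continuous (fun t : ℝ => t ^ q) := Real.continuous_rpow_const (by linarith)
  have hF := intervalIntegral.integral_eq_sub_of_hasDerivAt_of_le (a := 0) (b := 1)
    (f := fun t : ℝ => t * (t ^ q) ^ n * (1 - t ^ q) ^ (a + 1))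
    (f' := fun t : ℝ => (q * n + 1) * ((t ^ q) ^ n * (1 - t ^ q) ^ a)
      - (q * n + 1 + q * (a + 1)) * ((t ^ q) ^ (n + 1) * (1 - t ^ q) ^ a))
    zero_le_one ?_ ?_ ?_
  · rw [intervalIntegral.integral_sub ((aux_intn ha hq n).const_mul _)
      ((aux_intn ha hq (n + 1)).const_mul _), intervalIntegral.integral_const_mul,
      intervalIntegral.integral_const_mul] at hF
    have h0 : (0:ℝ) ^ (a + 1) = 0 := Real.zero_rpow (by linarith)
    simp only [Real.one_rpow, sub_self, h0, mul_zero, zero_mul, sub_zero] at hF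
    have hq0 : q ≠ 0 := by linarith
    field_simp
    linarith
  · refine Continuous.continuousOn ?_
    exact (continuous_id.mul (hc.pow n)).mul
      ((Real.continuous_rpow_const (by linarith)).comp (continuous_const.sub hc))
  · intro t ht
    obtain ⟨hu0, hu1⟩ := aux_mem hq ht.1.le ht.2.le
    have hpos : 0 < 1 - t ^ q := by linarith [ht.2]
    have hu : HasDerivAt (fun t : ℝ => t ^ q) (q * t ^ (q - 1)) t :=
      Real.hasDerivAt_rpow_const (Or.inl ht.1.ne')
    have htu : t * t ^ (q - 1) = t ^ q := by
      rw [Real.rpow_sub_one ht.1.ne']; field_simp [ht.1.ne']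
    have hv := (hu.const_sub 1).rpow_const (p := a + 1) (Or.inl hpos.ne')
    have := ((hasDerivAt_id t).mul (hu.pow n)).mul hv
    refine this.congr_deriv ?_
    have e1 : (1 - t ^ q) ^ (a + 1) = (1 - t ^ q) ^ a * (1 - t ^ q) := Real.rpow_add_one hpos.ne' a
    simp only [id, Pi.mul_apply, Pi.pow_apply, add_sub_cancel_right, e1]
    have e2 : t * ((n:ℝ) * (t ^ q) ^ (n - 1) * (q * t ^ (q - 1))) = n * q * (t ^ q) ^ n := by
      cases n with
      | zero => simp
      | succ m => 
        rw [Nat.add_sub_cancel, pow_succ (t ^ q) m, ← htu]; ring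
    rw [e2, pow_succ]
    linear_combination (-(t ^ q) ^ n * q * (a + 1) * (1 - t ^ q) ^ a) * htu
  · exact ((aux_intn ha hq n).const_mul _).sub ((aux_intn ha hq (n + 1)).const_mul _)

lemma aux_moment {a q : ℝ} (ha : -1 < a) (hq : 1 < q) (n : ℕ) :
    (∫ t in (0:ℝ)..1, (t ^ q) ^ n * (1 - t ^ q) ^ a)
      = (∫ t in (0:ℝ)..1, (1 - t ^ q) ^ a) *
        ((ascPochhammer ℝ n).eval (1 / q) / (ascPochhammer ℝ n).eval (a + 1 + 1 / q)) := by
  have hq' : 0 < 1 / q := by positivity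
  induction n with
  | zero => simp
  | succ n ih =>
    have h := aux_rec ha hq n
    have hp : 0 < a + 1 + 1 / q + n := by
      have : (0:ℝ) ≤ n := n.cast_nonneg
      linarith
    have hP : 0 < (ascPochhammer ℝ n).eval (a + 1 + 1 / q) := ascPochhammer_pos n _ (by linarith)
    rw [ih] at h
    rw [ascPochhammer_succ_eval, ascPochhammer_succ_eval, ← mul_right_inj' hp.ne', h]
    generalize 1 / q = b at *
    field_simp

theorem genK_series (p q r : ℝ) (hp : p < 0 ∨ 1 < p) (hq : 1 < q) (hr : 1 < r)
    (k : ℝ) (hk : k ∈ Ico (0:ℝ) 1)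
    (pipq : ℝ) (hpipq : pipq = 2 * ∫ t in (0:ℝ)..1, (1 - t ^ q) ^ (-(1 / p))) :
    Summable (fun n : ℕ =>
      (ascPochhammer ℝ n).eval (1 / q) * (ascPochhammer ℝ n).eval (1 / r)
        / ((ascPochhammer ℝ n).eval (1 - 1 / p + 1 / q) * (n.factorial : ℝ))
        * k ^ (q * n))
    ∧ genK p q r k = (pipq / 2) * ∑' n : ℕ,
      (ascPochhammer ℝ n).eval (1 / q) * (ascPochhammer ℝ n).eval (1 / r)
        / ((ascPochhammer ℝ n).eval (1 - 1 / p + 1 / q) * (n.factorial : ℝ))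
        * k ^ (q * n) := by
  obtain ⟨hk0, hk1⟩ := hk
  set a : ℝ := -(1 / p) with ha_def
  have ha : -1 < a := by
    rcases hp with h | h
    · have : 1 / p < 0 := one_div_neg.mpr h
      linarith
    · have : 1 / p < 1 := by rw [div_lt_one (by linarith)]; exact h
      linarith
  have hc : 1 - 1 / p + 1 / q = a + 1 + 1 / q := by rw [ha_def]; ring
  rw [hc]
  have hx0 : 0 ≤ k ^ q := by positivity
  have hx1 : k ^ q < 1 := lt_of_le_of_lt (aux_mem hq hk0 hk1.le).2 hk1
  have hs : 0 < 1 / r := by positivity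
  have hco : ∀ n : ℕ, 0 ≤ (ascPochhammer ℝ n).eval (1 / r) / (n.factorial : ℝ) := fun n =>
    div_nonneg (ascPochhammer_pos n _ hs).le (by positivity)
  have hsum0 := aux_binom (1 / r) (k ^ q) (by rw [abs_of_nonneg hx0]; exact hx1)
  have hI := aux_int ha hq
  have hIpos : 0 < ∫ t in (0:ℝ)..1, (1 - t ^ q) ^ a := by
    refine intervalIntegral.intervalIntegral_pos_of_pos_on hI ?_ zero_lt_one
    intro t ht
    have := (aux_mem hq ht.1.le ht.2.le).2
    exact Real.rpow_pos_of_pos (by linarith [ht.2]) _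
  have hmain : HasSum (fun n : ℕ => ∫ t in (0:ℝ)..1,
      ((ascPochhammer ℝ n).eval (1 / r) / (n.factorial : ℝ) * (k ^ q) ^ n) *
        ((t ^ q) ^ n * (1 - t ^ q) ^ a)) (genK p q r k) := by
    unfold genK
    refine intervalIntegral.hasSum_integral_of_dominated_convergence
      (fun n t => ((ascPochhammer ℝ n).eval (1 / r) / (n.factorial : ℝ) * (k ^ q) ^ n) *
        (1 - t ^ q) ^ a) ?_ ?_ ?_ ?_ ?_
    · intro n
      exact Measurable.aestronglyMeasurable (by fun_prop)
    · intro n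
      refine Eventually.of_forall fun t ht => ?_
      rw [uIoc_of_le zero_le_one] at ht
      obtain ⟨hu0, hu1⟩ := aux_mem hq ht.1.le ht.2
      have hA : 0 ≤ (1 - t ^ q) ^ a := Real.rpow_nonneg (by linarith [ht.2]) _
      have hB : (t ^ q) ^ n ≤ 1 := pow_le_one₀ hu0 (by linarith [ht.2])
      have hC := mul_nonneg (hco n) (pow_nonneg hx0 n)
      rw [Real.norm_of_nonneg (mul_nonneg hC (mul_nonneg (pow_nonneg hu0 n) hA))]
      exact mul_le_mul_of_nonneg_left (mul_le_of_le_one_left hA hB) hC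
    · exact Eventually.of_forall fun t _ => hsum0.summable.mul_right _
    · simp_rw [tsum_mul_right]
      exact hI.const_mul _
    · refine Eventually.of_forall fun t ht => ?_
      rw [uIoc_of_le zero_le_one] at ht
      obtain ⟨hu0, hu1⟩ := aux_mem hq ht.1.le ht.2
      have hy : k ^ q * t ^ q < 1 :=
        lt_of_le_of_lt (mul_le_of_le_one_right hx0 (by linarith [ht.2])) hx1
      have h := (aux_binom (1 / r) (k ^ q * t ^ q)
        (by rw [abs_of_nonneg (mul_nonneg hx0 hu0)]; exact hy)).mul_left ((1 - t ^ q) ^ a)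
      refine Eq.mp (congrArg (fun F : ℕ → ℝ => HasSum F _) (funext fun n => Eq.symm ?_)) h
      rw [mul_pow]; ring
  have hterm : ∀ n : ℕ, (∫ t in (0:ℝ)..1,
      ((ascPochhammer ℝ n).eval (1 / r) / (n.factorial : ℝ) * (k ^ q) ^ n) *
        ((t ^ q) ^ n * (1 - t ^ q) ^ a)) = (∫ t in (0:ℝ)..1, (1 - t ^ q) ^ a) *
      ((ascPochhammer ℝ n).eval (1 / q) * (ascPochhammer ℝ n).eval (1 / r)
        / ((ascPochhammer ℝ n).eval (a + 1 + 1 / q) * (n.factorial : ℝ))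
        * k ^ (q * n)) := by
    intro n
    rw [intervalIntegral.integral_const_mul, aux_moment ha hq, Real.rpow_mul_natCast hk0]
    have hP : 0 < (ascPochhammer ℝ n).eval (a + 1 + 1 / q) := ascPochhammer_pos n _ (by
      have : 0 < 1 / q := by positivity
      linarith)
    field_simp
  simp_rw [hterm] at hmain
  have hS := (summable_mul_left_iff hIpos.ne').mp hmain.summable
  refine ⟨hS, ?_⟩
  rw [hpipq, mul_div_cancel_left₀ _ two_ne_zero, ← tsum_mul_left]
  exact hmain.tsum_eq.symm
end
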